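/- Let n ≥ 1, α_1, …, α_n ∈ 𝔻, γ ∈ 𝔻, and let F : 𝔻ⁿ → 𝔻 be holomorphic such that F(λ·m_{α_1}(λ), …, λ·m_{α_n}(λ)) = λ·m_γ(λ) for all λ ∈ 𝔻. Then γ is a convex combination of α_1, …, α_n (there exist t_1, …, t_n ≥ 0 with t_1 + … + t_n = 1 and γ = Σ_j t_j·α_j). Moreover, for every t ∈ [0,1] the equality F(λ·m_{t·α_1}(λ), …, λ·m_{t·α_n}(λ)) = λ·m_{t·γ}(λ) holds for all λ ∈ 𝔻. -/

import Mathlib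

open Complex Set ComplexConjugate

noncomputable section

/-- The Möbius factor `m_a(l) = (a - l)/(1 - conj a · l)`. -/
def mob (a l : ℂ) : ℂ := (a - l) / (1 - conj a * l)

/-- The open unit disc in `ℂ`. -/
def uDisc : Set ℂ := {z : ℂ | ‖z‖ < 1}

/-- The open unit polydisc in `ℂⁿ`. -/
def uPolydisc (n : ℕ) : Set (Fin n → ℂ) := {z | ∀ i, ‖z i‖ < 1}

/-- `B` is (on the unit disc) a Blaschke product of degree exactly `d`. -/
def IsBlaschkeDeg (d : ℕ) (B : ℂ → ℂ) : Prop :=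
  ∃ c : ℂ, ‖c‖ = 1 ∧ ∃ a : Fin d → ℂ, (∀ j, ‖a j‖ < 1) ∧
    ∀ l ∈ uDisc, B l = c * ∏ j, mob (a j) l

/-- `B` is a Blaschke product of degree at most `k`. -/
def IsBlaschkeLe (k : ℕ) (B : ℂ → ℂ) : Prop := ∃ d ≤ k, IsBlaschkeDeg d B

/-- `F` is an interpolating function of the `N`-point Pick problem on `𝔻ⁿ` with
nodes `z j` and targets `lam j`. -/
def Interpolates (n N : ℕ) (z : Fin N → Fin n → ℂ) (lam : Fin N → ℂ)
    (F : (Fin n → ℂ) → ℂ) : Prop :=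
  DifferentiableOn ℂ F (uPolydisc n) ∧ (∀ x ∈ uPolydisc n, ‖F x‖ ≤ 1) ∧
    ∀ j, F (z j) = lam j

/-- The `N`-point Pick problem on `𝔻ⁿ` is extremal: it is solvable, but not solvable
with supremum norm less than `1`. -/
def ExtremalPick (n N : ℕ) (z : Fin N → Fin n → ℂ) (lam : Fin N → ℂ) : Prop :=
  (∃ F, Interpolates n N z lam F) ∧
    ¬ ∃ F : (Fin n → ℂ) → ℂ, DifferentiableOn ℂ F (uPolydisc n) ∧
      (∃ r : ℝ, r < 1 ∧ ∀ x ∈ uPolydisc n, ‖F x‖ ≤ r) ∧ ∀ j, F (z j) = lam j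

/-- A three-point Pick problem is degenerate if one of its two-point subproblems
is extremal. -/
def DegeneratePick (n : ℕ) (z : Fin 3 → Fin n → ℂ) (lam : Fin 3 → ℂ) : Prop :=
  ∃ i j : Fin 3, i ≠ j ∧ ExtremalPick n 2 ![z i, z j] ![lam i, lam j]

/-- `F` depends only on the coordinates in `S`. -/
def DependsOnlyOn (n : ℕ) (S : Finset (Fin n)) (F : (Fin n → ℂ) → ℂ) : Prop :=
  ∀ x ∈ uPolydisc n, ∀ y ∈ uPolydisc n, (∀ i ∈ S, x i = y i) → F x = F y

/-- The Pick problem is `k`-dimensional: some interpolating function depends only on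
`k` of the coordinates. -/
def KDim (n N k : ℕ) (z : Fin N → Fin n → ℂ) (lam : Fin N → ℂ) : Prop :=
  ∃ S : Finset (Fin n), S.card ≤ k ∧ ∃ F, Interpolates n N z lam F ∧ DependsOnlyOn n S F

/-- The Poincaré (hyperbolic) distance on the unit disc. -/
def hypDist (a b : ℂ) : ℝ :=
  Real.log ((1 + ‖(a - b) / (1 - conj b * a)‖) / (1 - ‖(a - b) / (1 - conj b * a)‖))

/-- `φ` is a unimodular constant on the disc. -/
def IsUnimodConst (φ : ℂ → ℂ) : Prop := ∃ c : ℂ, ‖c‖ = 1 ∧ ∀ l ∈ uDisc, φ l = c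

/-- `φ` coincides on the disc with a holomorphic automorphism of the disc (a Möbius map). -/
def IsDiscAut (φ : ℂ → ℂ) : Prop :=
  ∃ c a : ℂ, ‖c‖ = 1 ∧ ‖a‖ < 1 ∧ ∀ l ∈ uDisc, φ l = c * mob a l

/-- The magic function `Φ_{s,η}`. -/
def PhiMagic (s : ℝ) (η z1 z2 : ℂ) : ℂ :=
  ((s:ℂ) * z1 + (1 - (s:ℂ)) * z2 - η * z1 * z2) /
    (1 - ((1 - (s:ℂ)) * z1 + (s:ℂ) * z2) * η)

/-- The rational function of formula (F), with `ω = (conj α1 − conj α2)/(α1 − α2)`. -/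
def magicF (t : ℝ) (η α1 α2 z1 z2 : ℂ) : ℂ :=
  ((t:ℂ) * z1 + conj η * (1 - (t:ℂ)) * z2 +
      ((conj α1 - conj α2) / (α1 - α2)) * conj η * z1 * z2) /
    (1 + (((1 - (t:ℂ)) * z1 + (t:ℂ) * conj η * z2) *
      ((conj α1 - conj α2) / (α1 - α2))))

/-- A function of two variables of the form (F). -/
def IsMagicForm (F : ℂ → ℂ → ℂ) : Prop :=
  ∃ t ∈ Ioo (0:ℝ) 1, ∃ η α1 α2 : ℂ, ‖η‖ = 1 ∧ ‖α1‖ < 1 ∧ ‖α2‖ < 1 ∧ α1 ≠ α2 ∧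
    ∀ z1 z2 : ℂ, ‖z1‖ < 1 → ‖z2‖ < 1 → F z1 z2 = magicF t η α1 α2 z1 z2

open Filter Topology Asymptotics Metric

theorem aux_strict {E : Type*} [NormedAddCommGroup E] [NormedSpace ℂ E] (F : E → ℂ)
    (hFd : DifferentiableOn ℂ F (ball 0 1)) (hFm : ∀ x ∈ ball (0:E) 1, ‖F x‖ ≤ 1) :
    HasStrictFDerivAt F (fderiv ℂ F 0) 0 := by
  have hlip : ∀ x ∈ ball (0:E) (1/2), ∀ y ∈ ball (0:E) (1/2), ‖F (x + y) - F x‖ ≤ 4 * ‖y‖ := by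
    intro x hx y hy
    rw [mem_ball_zero_iff] at hx hy
    have hsub : ball x (1/2) ⊆ ball (0:E) 1 := by
      intro z hz
      rw [mem_ball_iff_norm] at hz
      rw [mem_ball_zero_iff]
      have := norm_add_le (z - x) x
      rw [sub_add_cancel] at this
      linarith
    have h := Complex.dist_le_div_mul_dist_of_mapsTo_ball (f := F) (c := x) (z := x + y)
      (R₁ := 1/2) (R₂ := 2) (hFd.mono hsub) (by
        intro z hz
        rw [mem_closedBall_iff_norm]
        have h1 := hFm z (hsub hz)
        have h2 := hFm x (hsub (mem_ball_self (by norm_num)))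
        have := norm_sub_le (F z) (F x)
        linarith) (by rw [mem_ball_iff_norm]; simpa using hy)
    rw [dist_eq_norm, dist_eq_norm] at h
    simp only [add_sub_cancel_left] at h
    linarith
  have hnear : ∀ᶠ y in 𝓝 (0:E), y ∈ ball (0:E) (1/2) := ball_mem_nhds _ (by norm_num)
  apply hasStrictFDerivAt_of_hasFDerivAt_of_continuousAt (f' := fun y => fderiv ℂ F y)
  · filter_upwards [hnear] with y hy
    exact (hFd.differentiableAt (isOpen_ball.mem_nhds (ball_subset_ball (by norm_num) hy))).hasFDerivAt
  · rw [ContinuousAt, tendsto_iff_norm_sub_tendsto_zero]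
    refine squeeze_zero' (g := fun y => 16 * ‖y‖) (Eventually.of_forall fun _ => norm_nonneg _) ?_ ?_
    · filter_upwards [hnear] with y hy
      have hd0 : ∀ x ∈ ball (0:E) (1/2), DifferentiableAt ℂ (fun x => F (x + y)) x := by
        intro x hx
        have : x + y ∈ ball (0:E) 1 := by
          rw [mem_ball_zero_iff] at *
          have := norm_add_le x y
          linarith
        have h := hFd.differentiableAt (isOpen_ball.mem_nhds this)
        exact h.comp x (by fun_prop : DifferentiableAt ℂ (fun x => x + y) x)
      have hd1 : ∀ x ∈ ball (0:E) (1/2), DifferentiableAt ℂ F x := fun x hx =>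
        hFd.differentiableAt (isOpen_ball.mem_nhds (ball_subset_ball (by norm_num) hx))
      have h0 : (0:E) ∈ ball (0:E) (1/2) := mem_ball_self (by norm_num)
      have h := Complex.norm_fderiv_le_div_of_mapsTo_ball (f := fun x => F (x + y) - F x)
        (c := (0:E)) (R₁ := 1/2) (R₂ := 8 * ‖y‖)
        (fun x hx => ((hd0 x hx).sub (hd1 x hx)).differentiableWithinAt) (by
          intro x hx
          rw [mem_closedBall_iff_norm]
          have h1 := hlip x hx y hy
          have h2 := hlip 0 h0 y hy
          have := norm_sub_le (F (x + y) - F x) (F (0 + y) - F 0)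
          linarith) (by norm_num)
      rw [fderiv_fun_sub (hd0 0 h0) (hd1 0 h0), fderiv_comp_add_right, zero_add] at h
      linarith
    · have : Tendsto (fun y : E => 16 * ‖y‖) (𝓝 0) (𝓝 (16 * ‖(0:E)‖)) :=
        (continuous_const.mul continuous_norm).tendsto 0
      simpa using this

def aux_E2 (f : ℂ → ℂ) (b1 b2 : ℂ) : Prop :=
  (fun l => f l - (b1 * l + b2 * l ^ 2)) =o[𝓝 0] (fun l : ℂ => l ^ 2)

theorem aux_E2_of_deriv {f g : ℂ → ℂ} {g' : ℂ} (hg : HasDerivAt g g' 0)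
    (hfg : ∀ l, f l = l * g l) : aux_E2 f (g 0) g' := by
  have h := hasDerivAt_iff_isLittleO.1 hg
  have h2 := (isBigO_refl (fun l : ℂ => l) (𝓝 0)).mul_isLittleO h
  refine h2.congr (fun l => ?_) (fun l => ?_)
  · rw [hfg]; simp only [smul_eq_mul]; ring
  · ring

theorem aux_E2_unique {f : ℂ → ℂ} {b1 b2 c1 c2 : ℂ} (h1 : aux_E2 f b1 b2) (h2 : aux_E2 f c1 c2) :
    b1 = c1 ∧ b2 = c2 := by
  have h : (fun l : ℂ => (c1 - b1) * l + (c2 - b2) * l ^ 2) =o[𝓝 0] (fun l : ℂ => l ^ 2) :=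
    (h1.sub h2).congr_left (fun l => by ring)
  have hl : (fun l : ℂ => l ^ 2) =o[𝓝 0] (fun l : ℂ => l) := by
    simpa using isLittleO_pow_id (𝕜 := ℂ) (n := 2) (by norm_num)
  have hx : (fun l : ℂ => (c1 - b1) * l) =o[𝓝 0] (fun l : ℂ => l) :=
    ((h.trans hl).sub (hl.const_mul_left (c2 - b2))).congr_left (fun l => by ring)
  have e1 : c1 - b1 = 0 := by
    by_contra hne
    rw [isLittleO_const_mul_left_iff hne] at hx
    refine isLittleO_irrefl ?_ hx
    rw [frequently_iff_neBot] 
    have : (𝓝[≠] (0:ℂ)).NeBot := inferInstance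
    exact this
  have e2 : c2 - b2 = 0 := by
    by_contra hne
    rw [e1] at h
    simp only [zero_mul, zero_add] at h
    rw [isLittleO_const_mul_left_iff hne] at h
    refine isLittleO_irrefl ?_ h
    have h3 : ∃ᶠ l : ℂ in 𝓝 0, l ≠ 0 := by
      rw [frequently_iff_neBot]
      have : (𝓝[≠] (0:ℂ)).NeBot := inferInstance
      exact this
    exact h3.mono (fun l hl => pow_ne_zero 2 hl)
  exact ⟨(sub_eq_zero.1 e1).symm, (sub_eq_zero.1 e2).symm⟩

theorem aux_den {a z : ℂ} (ha : ‖a‖ < 1) (hz : ‖z‖ ≤ 1) : 1 - conj a * z ≠ 0 := by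
  intro h
  have h1 : conj a * z = 1 := (sub_eq_zero.1 h).symm
  have h2 : ‖a‖ * ‖z‖ = 1 := by
    rw [← Complex.norm_conj a, ← norm_mul, h1, norm_one]
  nlinarith [norm_nonneg a, norm_nonneg z]

theorem aux_mob_le {a z : ℂ} (ha : ‖a‖ < 1) (hz : ‖z‖ ≤ 1) : ‖mob a z‖ ≤ 1 := by
  unfold mob
  rw [norm_div, div_le_one (norm_pos_iff.2 (aux_den ha hz))]
  rw [← sq_le_sq₀ (norm_nonneg _) (norm_nonneg _), Complex.sq_norm, Complex.sq_norm]
  have h1 : ‖a‖ ^ 2 < 1 := by nlinarith [norm_nonneg a]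
  have h2 : ‖z‖ ^ 2 ≤ 1 := by nlinarith [norm_nonneg z]
  rw [Complex.sq_norm] at h1 h2
  simp only [Complex.normSq_apply, sub_re, sub_im, mul_re, mul_im, conj_re, conj_im, one_re, one_im]
    at *
  nlinarith [mul_nonneg (sub_nonneg.2 h1.le) (sub_nonneg.2 h2)]

theorem aux_mob_invol {a z : ℂ} (ha : ‖a‖ < 1) (hz : ‖z‖ ≤ 1) : mob a (mob a z) = z := by
  have h1 := aux_den ha hz
  have h2 := aux_den ha ha.le
  unfold mob
  have h3 : 1 - conj a * ((a - z) / (1 - conj a * z)) = (1 - conj a * a) / (1 - conj a * z) := by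
    field_simp; ring
  have h4 : a - (a - z) / (1 - conj a * z) = z * (1 - conj a * a) / (1 - conj a * z) := by
    rw [eq_div_iff h1, sub_mul, div_mul_cancel₀ _ h1]; ring
  rw [h3, h4, div_div_div_cancel_right₀ h1, mul_div_cancel_right₀ _ h2]

theorem aux_mob_deriv {a z : ℂ} (hz : 1 - conj a * z ≠ 0) :
    HasDerivAt (mob a) (-(1 - conj a * a) / (1 - conj a * z) ^ 2) z := by
  have h1 : HasDerivAt (fun l : ℂ => a - l) (-1) z := (hasDerivAt_id z).const_sub a
  have h2 : HasDerivAt (fun l : ℂ => 1 - conj a * l) (-(conj a * 1)) z :=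
    ((hasDerivAt_id z).const_mul (conj a)).const_sub 1
  exact (h1.div h2 hz).congr_deriv (by ring)

theorem aux_schwarz2 {f : ℂ → ℂ} {b1 b2 : ℂ} (hd : DifferentiableOn ℂ f (ball 0 1))
    (hm : ∀ z ∈ ball (0:ℂ) 1, ‖f z‖ ≤ 1) (h0 : f 0 = 0) (hE : aux_E2 f b1 b2) (hb : ‖b1‖ < 1) :
    ‖b2‖ ≤ 1 - ‖b1‖ ^ 2 ∧
      (b2 = -((1 - ‖b1‖ ^ 2 : ℝ) : ℂ) → ∀ l ∈ ball (0:ℂ) 1, f l = l * mob b1 l) := by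
  set g := dslope f 0 with hg
  have h0m : (0:ℂ) ∈ ball (0:ℂ) 1 := mem_ball_self one_pos
  have hnhd : ball (0:ℂ) 1 ∈ 𝓝 (0:ℂ) := isOpen_ball.mem_nhds h0m
  have hgd : DifferentiableOn ℂ g (ball 0 1) := (Complex.differentiableOn_dslope hnhd).2 hd
  have hfg : ∀ l, f l = l * g l := by
    intro l
    have := sub_smul_dslope f 0 l
    simp only [sub_zero, h0, smul_eq_mul] at this
    exact this.symm
  have hgm : ∀ z ∈ ball (0:ℂ) 1, ‖g z‖ ≤ 1 := by
    intro z hz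
    have := Complex.norm_dslope_le_div_of_mapsTo_ball (R₂ := 1) hd (by
      intro w hw; rw [h0, mem_closedBall_zero_iff]; exact hm w hw) hz
    simpa using this
  have hg' := (hgd.differentiableAt hnhd).hasDerivAt
  obtain ⟨e1, e2⟩ := aux_E2_unique hE (aux_E2_of_deriv hg' hfg)
  rw [← e2] at hg'
  have hsq : (1 - conj b1 * b1) = ((1 - ‖b1‖ ^ 2 : ℝ) : ℂ) := by
    rw [Complex.conj_mul']; push_cast; rfl
  have hpos : 0 < 1 - ‖b1‖ ^ 2 := by nlinarith [norm_nonneg b1]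
  have hposC : ((1 - ‖b1‖ ^ 2 : ℝ) : ℂ) ≠ 0 := by exact_mod_cast hpos.ne'
  set u : ℂ → ℂ := fun l => mob b1 (g l) with hu
  have hud : DifferentiableOn ℂ u (ball 0 1) := by
    intro z hz
    have := (aux_mob_deriv (aux_den hb (hgm z hz))).differentiableAt
    exact (this.comp z (hgd.differentiableAt (isOpen_ball.mem_nhds hz))).differentiableWithinAt
  have hu0 : u 0 = 0 := by simp [hu, ← e1, mob]
  have hum : MapsTo u (ball 0 1) (closedBall (u 0) 1) := by
    intro z hz
    rw [hu0, mem_closedBall_zero_iff]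
    exact aux_mob_le hb (hgm z hz)
  have hu' : HasDerivAt u (-b2 / ((1 - ‖b1‖ ^ 2 : ℝ) : ℂ)) 0 := by
    have h1 := aux_mob_deriv (aux_den hb (hgm 0 h0m))
    have h2 := h1.comp (0:ℂ) hg'
    refine h2.congr_deriv ?_
    rw [← e1, hsq]
    field_simp
  constructor
  · have := Complex.norm_deriv_le_one_of_mapsTo_ball hud hum one_pos
    rw [hu'.deriv, norm_div, norm_neg, Complex.norm_real, Real.norm_of_nonneg hpos.le,
      div_le_one hpos] at this
    exact this
  · intro hb2 l hl
    have hone : dslope u 0 0 = 1 := by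
      rw [dslope_same, hu'.deriv, hb2, neg_neg, div_self hposC]
    have h := Complex.affine_of_mapsTo_ball_of_norm_dslope_eq_div hud hum h0m
      (by rw [hone]; simp) hl
    simp only [hu0, hone, sub_zero, smul_eq_mul, mul_one, zero_add] at h
    rw [hfg, ← aux_mob_invol hb (hgm l hl)]
    congr 2

theorem aux_key {n : ℕ} (α : Fin n → ℂ) (F : (Fin n → ℂ) → ℂ) (L : (Fin n → ℂ) →L[ℂ] ℂ)
    (hL : HasStrictFDerivAt F L 0) (c q : ℂ)
    (hh : aux_E2 (fun l => F (fun i => l * α i)) c q) (t : ℝ) :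
    aux_E2 (fun l => F (fun i => l * mob ((t:ℂ) * α i) l)) (t * c)
      (t ^ 2 * q + L (fun i => -(1 - (t:ℂ) ^ 2 * ((‖α i‖ ^ 2 : ℝ) : ℂ)))) := by
  set w : Fin n → ℂ := fun i => -(1 - (t:ℂ) ^ 2 * ((‖α i‖ ^ 2 : ℝ) : ℂ)) with hw
  set x : ℂ → Fin n → ℂ := fun l i => l * mob ((t:ℂ) * α i) l with hx
  set y : ℂ → Fin n → ℂ := fun l i => (t * l) * α i with hy
  have hden : ∀ i, Tendsto (fun l : ℂ => 1 - conj ((t:ℂ) * α i) * l) (𝓝 0) (𝓝 1) := by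
    intro i
    have : Continuous (fun l : ℂ => 1 - conj ((t:ℂ) * α i) * l) := by fun_prop
    simpa using this.tendsto 0
  have hxy : (fun l => x l - y l - l ^ 2 • w) =o[𝓝 0] (fun l : ℂ => l ^ 2) := by
    rw [isLittleO_pi]
    intro i
    have h1 : Tendsto (fun l : ℂ => w i * ((1 - conj ((t:ℂ) * α i) * l)⁻¹ - 1)) (𝓝 0) (𝓝 0) := by
      have := (((hden i).inv₀ one_ne_zero).sub_const 1).const_mul (w i)
      simpa using this
    have h2 := (isBigO_refl (fun l : ℂ => l ^ 2) (𝓝 0)).mul_isLittleO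
      ((isLittleO_one_iff ℂ).2 h1)
    refine h2.congr' ?_ (Eventually.of_forall fun l => by simp)
    filter_upwards [(hden i).eventually_ne one_ne_zero] with l hl
    have e : (((‖α i‖ ^ 2 : ℝ)) : ℂ) = conj (α i) * α i := by
      rw [Complex.conj_mul']; push_cast; rfl
    simp only [hx, hy, hw, Pi.sub_apply, Pi.smul_apply, smul_eq_mul, mob, e, map_mul, conj_ofReal] at hl ⊢
    have hl' := mul_inv_cancel₀ hl
    rw [div_eq_mul_inv]
    linear_combination (-(l * t * α i)) * hl'
  have hO : (fun l => x l - y l) =O[𝓝 0] (fun l : ℂ => l ^ 2) := by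
    have h1 : (fun l : ℂ => l ^ 2 • w) =O[𝓝 0] (fun l : ℂ => l ^ 2) := by
      refine IsBigO.of_bound ‖w‖ (Eventually.of_forall fun l => ?_)
      rw [norm_smul, mul_comm]
    refine (hxy.isBigO.add h1).congr_left (fun l => by simp)
  have hx0 : Tendsto x (𝓝 0) (𝓝 0) := by
    rw [tendsto_pi_nhds]
    intro i
    have : Tendsto (fun l : ℂ => l * (((t:ℂ) * α i - l) / (1 - conj ((t:ℂ) * α i) * l))) (𝓝 0)
        (𝓝 (0 * (((t:ℂ) * α i - 0) / 1))) :=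
      tendsto_id.mul ((tendsto_const_nhds.sub tendsto_id).div (hden i) one_ne_zero)
    simpa [hx, mob] using this
  have hy0 : Tendsto y (𝓝 0) (𝓝 0) := by
    have : Continuous y := by
      rw [continuous_pi_iff]; intro i; simp only [hy]; fun_prop
    have h := this.tendsto 0
    have e : y 0 = 0 := by ext i; simp [hy]
    rwa [e] at h
  have hxyt : Tendsto (fun l => (x l, y l)) (𝓝 0) (𝓝 ((0 : Fin n → ℂ), (0 : Fin n → ℂ))) :=
    hx0.prodMk_nhds hy0
  have A1 : (fun l => F (x l) - F (y l) - L (x l - y l)) =o[𝓝 0] (fun l : ℂ => l ^ 2) :=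
    ((hasStrictFDerivAt_iff_isLittleO.1 hL).comp_tendsto hxyt).trans_isBigO hO
  have A2 : (fun l => L (x l - y l - l ^ 2 • w)) =o[𝓝 0] (fun l : ℂ => l ^ 2) :=
    (L.isBigO_comp _ _).trans_isLittleO hxy
  have ht : Tendsto (fun l : ℂ => (t:ℂ) * l) (𝓝 0) (𝓝 0) := by
    have : Continuous (fun l : ℂ => (t:ℂ) * l) := by fun_prop
    simpa using this.tendsto 0
  have A3 : (fun l : ℂ => F (y l) - (c * (t * l) + q * (t * l) ^ 2)) =o[𝓝 0]
      (fun l : ℂ => l ^ 2) := by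
    have h1 := IsLittleO.comp_tendsto hh ht
    refine h1.trans_isBigO ?_
    refine IsBigO.of_bound (‖(t:ℂ)‖ ^ 2) (Eventually.of_forall fun l => ?_)
    simp [mul_pow]
  refine ((A1.add A2).add A3).congr_left (fun l => ?_)
  simp only [map_sub, map_smul, smul_eq_mul]
  ring

/-- if a holomorphic `F : 𝔻ⁿ → 𝔻` satisfies
`F(λ m_{α1}(λ), …, λ m_{αn}(λ)) = λ m_γ(λ)` then `γ` is a convex combination of the
`α j`, and the scaled identity holds for every `t ∈ [0,1]`. -/
theorem statement_13 (n : ℕ) (hn : 1 ≤ n) (α : Fin n → ℂ) (γ : ℂ)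
    (hα : ∀ i, ‖α i‖ < 1) (hγ : ‖γ‖ < 1)
    (F : (Fin n → ℂ) → ℂ)
    (hFd : DifferentiableOn ℂ F (uPolydisc n))
    (hFm : ∀ x ∈ uPolydisc n, ‖F x‖ < 1)
    (hleft : ∀ l ∈ uDisc, F (fun i => l * mob (α i) l) = l * mob γ l) :
    (∃ t : Fin n → ℝ, (∀ i, 0 ≤ t i) ∧ (∑ i, t i) = 1 ∧
      γ = ∑ i, (t i : ℂ) * α i) ∧
    ∀ t ∈ Icc (0:ℝ) 1, ∀ l ∈ uDisc,
      F (fun i => l * mob ((t:ℂ) * α i) l) = l * mob ((t:ℂ) * γ) l := by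

  have hball : uPolydisc n = ball (0 : Fin n → ℂ) 1 := by
    ext z
    rw [mem_ball_zero_iff, pi_norm_lt_iff one_pos]
    rfl
  have hdisc : uDisc = ball (0:ℂ) 1 := by
    ext z; rw [mem_ball_zero_iff]; rfl
  rw [hball] at hFd hFm
  rw [hdisc] at hleft
  rw [hdisc]
  have hL := aux_strict F hFd (fun x hx => (hFm x hx).le)
  set L := fderiv ℂ F 0 with hLdef
  have h0m : (0:ℂ) ∈ ball (0:ℂ) 1 := mem_ball_self one_pos
  have hnhd : ball (0:ℂ) 1 ∈ 𝓝 (0:ℂ) := isOpen_ball.mem_nhds h0m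
  have hF0 : F 0 = 0 := by
    have h := hleft 0 h0m
    simp only [zero_mul] at h
    exact h
  -- norm of the gradient
  have hL1 : ‖L‖ ≤ 1 := by
    have h := Complex.norm_fderiv_le_one_of_mapsTo_ball (f := F) hFd (by
      intro z hz
      rw [hF0, mem_closedBall_zero_iff]
      exact (hFm z hz).le) one_pos
    exact h
  set a : Fin n → ℂ := fun i => L (Pi.single i 1) with ha
  have hLa : ∀ v : Fin n → ℂ, L v = ∑ i, a i * v i := by
    intro v
    conv_lhs => rw [pi_eq_sum_univ' v]
    rw [map_sum]
    refine Finset.sum_congr rfl fun i _ => ?_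
    have : L (v i • Pi.single i (1:ℂ)) = a i * v i := by
      rw [map_smul, smul_eq_mul, mul_comm]
    rw [← this]
  have hsumnorm : ∑ i, ‖a i‖ ≤ 1 := by
    set s : Fin n → ℂ := fun i => conj (a i) / ‖a i‖ with hs
    have hs1 : ‖s‖ ≤ 1 := by
      rw [pi_norm_le_iff_of_nonneg zero_le_one]
      intro i
      simp only [hs, norm_div, Complex.norm_conj, Complex.norm_real, norm_norm]
      exact div_self_le_one _
    have h1 : L s = ((∑ i, ‖a i‖ : ℝ) : ℂ) := by
      rw [hLa]
      push_cast
      refine Finset.sum_congr rfl fun i _ => ?_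
      simp only [hs]
      by_cases h : a i = 0
      · simp [h]
      · have : ((‖a i‖ : ℝ) : ℂ) ≠ 0 := by exact_mod_cast norm_ne_zero_iff.2 h
        rw [mul_div_assoc', Complex.mul_conj', sq, mul_div_cancel_right₀ _ this]
    have h2 := (L.le_opNorm s).trans (mul_le_one₀ hL1 (norm_nonneg _) hs1)
    rw [h1, Complex.norm_real, Real.norm_of_nonneg (Finset.sum_nonneg fun i _ => norm_nonneg _)] at h2
    exact h2
  -- expansion of `l ↦ F (l α)`
  obtain ⟨c, q, hq⟩ : ∃ c q, aux_E2 (fun l => F (fun i => l * α i)) c q := by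
    set h : ℂ → ℂ := fun l => F (fun i => l * α i) with hh
    have hd : DifferentiableOn ℂ h (ball 0 1) := by
      refine hFd.comp (t := ball (0 : Fin n → ℂ) 1) ?_ ?_
      · apply Differentiable.differentiableOn
        rw [differentiable_pi]; intro i; fun_prop
      · intro l hl
        rw [mem_ball_zero_iff] at hl ⊢
        rw [pi_norm_lt_iff one_pos]
        intro i
        rw [norm_mul]
        nlinarith [hα i, norm_nonneg l, norm_nonneg (α i)]
    have h0 : h 0 = 0 := by
      simp only [hh, zero_mul]; exact hF0
    have hgd : DifferentiableOn ℂ (dslope h 0) (ball 0 1) :=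
      (Complex.differentiableOn_dslope hnhd).2 hd
    refine ⟨_, _, aux_E2_of_deriv (hgd.differentiableAt hnhd).hasDerivAt fun l => ?_⟩
    have := sub_smul_dslope h 0 l
    simp only [sub_zero, h0, smul_eq_mul] at this
    exact this.symm
  have hkey := aux_key α F L hL c q hq
  set A : ℂ := ∑ i, a i with hA
  set S : ℂ := q + ∑ i, a i * ((‖α i‖ ^ 2 : ℝ) : ℂ) with hS
  have hb2 : ∀ t : ℝ, (t:ℂ) ^ 2 * q + L (fun i => -(1 - (t:ℂ) ^ 2 * ((‖α i‖ ^ 2 : ℝ) : ℂ)))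
      = (t:ℂ) ^ 2 * S - A := by
    intro t
    rw [hLa, hS, hA, mul_add, Finset.mul_sum, add_sub_assoc, ← Finset.sum_sub_distrib]
    congr 1
    refine Finset.sum_congr rfl fun i _ => ?_
    ring
  -- expansion of the right-hand side
  have hR : aux_E2 (fun l => l * mob γ l) γ (-((1 - ‖γ‖ ^ 2 : ℝ) : ℂ)) := by
    have h1 := aux_mob_deriv (a := γ) (z := 0) (by simp)
    have h2 := aux_E2_of_deriv h1 (f := fun l => l * mob γ l) (fun l => rfl)
    have e1 : mob γ 0 = γ := by simp [mob]
    have e2 : -(1 - conj γ * γ) / (1 - conj γ * 0) ^ 2 = -((1 - ‖γ‖ ^ 2 : ℝ) : ℂ) := by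
      rw [Complex.conj_mul']; push_cast; simp
    rwa [e1, e2] at h2
  have h1 : γ = c ∧ -((1 - ‖γ‖ ^ 2 : ℝ) : ℂ) = S - A := by
    have h := hkey 1
    rw [hb2 1] at h
    simp only [ofReal_one, one_mul, one_pow] at h
    refine aux_E2_unique hR (h.congr' ?_ EventuallyEq.rfl)
    filter_upwards [hnhd] with l hl
    rw [hleft l hl]
  obtain ⟨hc, hSA⟩ := h1
  -- the general disc
  have hgen : ∀ t : ℝ, (∀ i, ‖(t:ℂ) * α i‖ < 1) → ‖(t:ℂ) * γ‖ < 1 →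
      ‖(t:ℂ) ^ 2 * S - A‖ ≤ 1 - ‖(t:ℂ) * γ‖ ^ 2 ∧
      ((t:ℂ) ^ 2 * S - A = -((1 - ‖(t:ℂ) * γ‖ ^ 2 : ℝ) : ℂ) → ∀ l ∈ ball (0:ℂ) 1,
        F (fun i => l * mob ((t:ℂ) * α i) l) = l * mob ((t:ℂ) * γ) l) := by
    intro t hta htg
    have h := hkey t
    rw [hb2 t, ← hc] at h
    have hmaps : MapsTo (fun l i => l * mob ((t:ℂ) * α i) l) (ball (0:ℂ) 1)
        (ball (0 : Fin n → ℂ) 1) := by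
      intro l hl
      rw [mem_ball_zero_iff] at hl ⊢
      rw [pi_norm_lt_iff one_pos]
      intro i
      rw [norm_mul]
      have := aux_mob_le (hta i) hl.le
      nlinarith [norm_nonneg l, norm_nonneg (mob ((t:ℂ) * α i) l)]
    refine aux_schwarz2 ?_ ?_ ?_ h htg
    · refine hFd.comp ?_ hmaps
      rw [differentiableOn_pi]
      intro i l hl
      have hl' := hl
      rw [mem_ball_zero_iff] at hl'
      have := (aux_mob_deriv (aux_den (hta i) hl'.le)).differentiableAt
      exact (differentiableAt_id.mul this).differentiableWithinAt
    · intro l hl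
      exact (hFm _ (hmaps hl)).le
    · simp only [zero_mul]; exact hF0
  -- a parameter slightly larger than one
  obtain ⟨t0, ht0, hta0, htg0⟩ : ∃ t : ℝ, 1 < t ∧ (∀ i, ‖(t:ℂ) * α i‖ < 1) ∧ ‖(t:ℂ) * γ‖ < 1 := by
    have hev : ∀ z : ℂ, ‖z‖ < 1 → ∀ᶠ t : ℝ in 𝓝[>] 1, ‖(t:ℂ) * z‖ < 1 := by
      intro z hz
      have hcont : Continuous (fun t : ℝ => ‖(t:ℂ) * z‖) := by fun_prop
      refine nhdsWithin_le_nhds ((hcont.tendsto 1).eventually_lt_const ?_)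
      simpa using hz
    have h1 : ∀ᶠ t : ℝ in 𝓝[>] 1, 1 < t := self_mem_nhdsWithin
    exact (h1.and ((eventually_all.2 fun i => hev _ (hα i)).and (hev _ hγ))).exists
  have hre : 1 ≤ A.re := by
    have h := (hgen t0 hta0 htg0).1
    have h2 := (abs_le.1 ((Complex.abs_re_le_norm _).trans h)).1
    have hSre : S.re = A.re - (1 - ‖γ‖ ^ 2) := by
      have := congrArg Complex.re hSA
      simp only [neg_re, ofReal_re, sub_re] at this
      linarith
    rw [sub_re, ← ofReal_pow, re_ofReal_mul, hSre, norm_mul, Complex.norm_real, mul_pow,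
      Real.norm_eq_abs, sq_abs] at h2
    have h3 : 0 < t0 ^ 2 - 1 := by nlinarith
    nlinarith
  have hAre : A.re = ∑ i, (a i).re := by rw [hA, Complex.re_sum]
  have hrele : ∀ i, (a i).re ≤ ‖a i‖ := fun i => Complex.re_le_norm _
  have hreeq : ∀ i, (a i).re = ‖a i‖ := by
    have hle : ∑ i, (a i).re ≤ ∑ i, ‖a i‖ := Finset.sum_le_sum fun i _ => hrele i
    have heq : ∑ i, (a i).re = ∑ i, ‖a i‖ := by linarith
    intro i
    exact (Finset.sum_eq_sum_iff_of_le fun i _ => hrele i).1 heq i (Finset.mem_univ i)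
  have haeq : ∀ i, a i = ((‖a i‖ : ℝ) : ℂ) := by
    intro i
    apply Complex.ext
    · simpa using hreeq i
    · have h1 := Complex.sq_norm (a i)
      rw [Complex.normSq_apply, ← hreeq i] at h1
      have h2 : (a i).im * (a i).im = 0 := by linarith
      simpa using mul_self_eq_zero.1 h2
  have hsum1 : ∑ i, ‖a i‖ = 1 := by
    have : ∑ i, (a i).re = ∑ i, ‖a i‖ := Finset.sum_congr rfl fun i _ => hreeq i
    linarith
  have hA1 : A = 1 := by
    rw [hA, Finset.sum_congr rfl fun i _ => haeq i, ← ofReal_sum, hsum1, ofReal_one]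
  have hcL : c = L α := by
    have h1 : HasDerivAt (fun l : ℂ => F (fun i => l * α i)) (L α) 0 := by
      have h2 : HasDerivAt (fun (l : ℂ) (i : Fin n) => l * α i) α 0 := by
        rw [hasDerivAt_pi]
        intro i
        simpa using (hasDerivAt_id (0:ℂ)).mul_const (α i)
      have h3 : HasFDerivAt F L ((fun (l : ℂ) (i : Fin n) => l * α i) 0) := by
        have e : (fun (l : ℂ) (i : Fin n) => l * α i) 0 = 0 := by ext i; simp
        rw [e]; exact hL.hasFDerivAt
      exact h3.comp_hasDerivAt 0 h2
    have h4 : HasDerivAt (fun l : ℂ => F (fun i => l * α i)) c 0 := by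
      rw [hasDerivAt_iff_isLittleO]
      have hl : (fun l : ℂ => l ^ 2) =o[𝓝 0] (fun l : ℂ => l) := by
        simpa using isLittleO_pow_id (𝕜 := ℂ) (n := 2) (by norm_num)
      have h5 := (IsLittleO.trans hq hl).add (hl.const_mul_left q)
      refine h5.congr (fun l => ?_) (fun l => by simp)
      simp only [zero_mul, sub_zero, smul_eq_mul]
      have : F (fun i => 0) = 0 := hF0
      rw [this]; ring
    exact h4.unique h1
  refine ⟨⟨fun i => ‖a i‖, fun i => norm_nonneg _, hsum1, ?_⟩, ?_⟩
  · rw [hc, hcL, hLa]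
    exact Finset.sum_congr rfl fun i _ => by rw [← haeq i]
  · intro t ht
    have hlt : ∀ z : ℂ, ‖z‖ < 1 → ‖(t:ℂ) * z‖ < 1 := by
      intro z hz
      rw [norm_mul, Complex.norm_real, Real.norm_of_nonneg ht.1]
      nlinarith [ht.1, ht.2, norm_nonneg z]
    refine (hgen t (fun i => hlt _ (hα i)) (hlt _ hγ)).2 ?_
    have hS1 : S = ((‖γ‖ ^ 2 : ℝ) : ℂ) := by
      rw [hA1] at hSA
      push_cast at hSA ⊢
      linear_combination -hSA
    rw [hS1, hA1, norm_mul, Complex.norm_real, Real.norm_of_nonneg ht.1]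
    push_cast
    ring
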